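/- arXiv:1903.01583 — 3 statements merged into one kernel-verified Lean document; each statement's English description precedes it below -/
import Mathlib

section
/- Let G = (V, A) be an interdependent network with parts V₁ and V₂, and suppose there exists an injective map f : V₁^out → V₂ such that for every u ∈ V₁^out both (u, f(u)) ∈ A and (f(u), u) ∈ A (i.e., each vertex of V₁^out forms a directed cycle of length 2 with a distinct partner in V₂). Then the survivability of G equals |V₁^out|, i.e., |H(G)| = |V₁^out|. -/
/-- A directed cycle: a list of `n ≥ 2` pairwise distinct vertices such that
each consecutive pair (cyclically) is an arc of `A`. -/
def IsCycle {V : Type*} (A : Set (V × V)) (l : List V) : Prop :=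
  2 ≤ l.length ∧ l.Nodup ∧
    ∀ i : Fin l.length,
      (l.get i,
       l.get ⟨(i.1 + 1) % l.length,
              Nat.mod_lt _ (Nat.lt_of_le_of_lt (Nat.zero_le _) i.isLt)⟩) ∈ A

/-- A directed walk from `u` to `v`: a nonempty list of vertices starting at `u`,
ending at `v`, in which every consecutive pair is an arc of `A`. -/
def IsWalk {V : Type*} (A : Set (V × V)) (l : List V) (u v : V) : Prop :=
  l ≠ [] ∧ l.head? = some u ∧ l.getLast? = some v ∧
    l.Chain' (fun a b => (a, b) ∈ A)

/-- The arc `a` lies on the cycle given by the list `l` (its endpoints are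
consecutive vertices of the cycle in cyclic order). -/
def ArcInCycle {V : Type*} (l : List V) (a : V × V) : Prop :=
  ∃ i : Fin l.length,
    l.get i = a.1 ∧
    l.get ⟨(i.1 + 1) % l.length,
           Nat.mod_lt _ (Nat.lt_of_le_of_lt (Nat.zero_le _) i.isLt)⟩ = a.2

/-- A cycle hitting set: a set of vertices meeting every directed cycle. -/
def IsHittingSet {V : Type*} (A : Set (V × V)) (S : Set V) : Prop :=
  ∀ l : List V, IsCycle A l → ∃ v ∈ S, v ∈ l

/-- The survivability `|H(G)|`: the minimum cardinality of a cycle hitting set. -/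
noncomputable def surv {V : Type*} (A : Set (V × V)) : ℕ :=
  sInf {n | ∃ S : Set V, IsHittingSet A S ∧ S.ncard = n}

/-- If every arc joins `V₁` to `V₂`, then the vertices of `V₁` with an outgoing arc meet every
directed cycle. -/
theorem isHittingSet_of_bipartite {V : Type*} {A : Set (V × V)} {V₁ V₂ : Set V}
    (hbip : ∀ a ∈ A, (a.1 ∈ V₁ ∧ a.2 ∈ V₂) ∨ (a.1 ∈ V₂ ∧ a.2 ∈ V₁)) :
    IsHittingSet A {u ∈ V₁ | ∃ v : V, (u, v) ∈ A} := by
  rintro l ⟨hlen, -, hl⟩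
  have h := hl ⟨0, by omega⟩
  rcases hbip _ h with ⟨h₁, -⟩ | ⟨-, h₂⟩
  · exact ⟨_, ⟨h₁, _, h⟩, List.get_mem _ _⟩
  · exact ⟨_, ⟨h₂, _, hl _⟩, List.get_mem _ _⟩

/-- Two distinct vertices joined by arcs in both directions form a directed cycle. -/
theorem isCycle_pair {V : Type*} {A : Set (V × V)} {u v : V} (hne : u ≠ v)
    (huv : (u, v) ∈ A) (hvu : (v, u) ∈ A) : IsCycle A [u, v] := by
  refine ⟨le_rfl, by simpa using hne, fun i => ?_⟩
  change Fin 2 at i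
  fin_cases i
  · exact huv
  · simpa using hvu

/-- A hitting set has at least as many vertices as there are 2-cycles `u, f u` with `u ∈ U`, when
`f` is injective on `U` and maps `U` outside of `U`. -/
theorem ncard_le_ncard_of_isHittingSet {V : Type*} [Finite V] {A : Set (V × V)} {U S : Set V}
    {f : V → V} (hinj : Set.InjOn f U) (hfU : ∀ u ∈ U, f u ∉ U)
    (hf : ∀ u ∈ U, (u, f u) ∈ A ∧ (f u, u) ∈ A) (hS : IsHittingSet A S) :
    U.ncard ≤ S.ncard := by
  have hmem : ∀ u ∈ U, u ∈ S ∨ f u ∈ S := by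
    intro u hu
    have hne : u ≠ f u := fun h => hfU u hu (h ▸ hu)
    obtain ⟨v, hvS, hv⟩ := hS _ (isCycle_pair hne (hf u hu).1 (hf u hu).2)
    simp only [List.mem_cons, List.not_mem_nil, or_false] at hv
    rcases hv with rfl | rfl
    · exact .inl hvS
    · exact .inr hvS
  classical
  refine Set.ncard_le_ncard_of_injOn (fun u => if u ∈ S then u else f u) ?_ ?_ (Set.toFinite S)
  · intro u hu
    have := hmem u hu
    grind
  · intro u hu w hw h
    have := hfU u hu
    have := hfU w hw
    have := @hinj u hu w hw
    grind

theorem stmt6 {V : Type*} [Fintype V] (A : Set (V × V))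
    (hloop : ∀ v : V, (v, v) ∉ A)
    (V₁ V₂ : Set V) (hpart : V₁ ∪ V₂ = Set.univ) (hdisj : Disjoint V₁ V₂)
    (hbip : ∀ a ∈ A, (a.1 ∈ V₁ ∧ a.2 ∈ V₂) ∨ (a.1 ∈ V₂ ∧ a.2 ∈ V₁))
    (f : V → V)
    (hinj : Set.InjOn f {u ∈ V₁ | ∃ v : V, (u, v) ∈ A})
    (hf : ∀ u ∈ {u ∈ V₁ | ∃ v : V, (u, v) ∈ A},
      f u ∈ V₂ ∧ (u, f u) ∈ A ∧ (f u, u) ∈ A) :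
    surv A = {u ∈ V₁ | ∃ v : V, (u, v) ∈ A}.ncard := by
  have hfU : ∀ u ∈ {u ∈ V₁ | ∃ v : V, (u, v) ∈ A}, f u ∉ {u ∈ V₁ | ∃ v : V, (u, v) ∈ A} :=
    fun u hu h => Set.disjoint_left.mp hdisj h.1 (hf u hu).1
  have hU := isHittingSet_of_bipartite hbip
  refine le_antisymm (Nat.sInf_le ⟨_, hU, rfl⟩) (le_csInf ⟨_, _, hU, rfl⟩ ?_)
  rintro _ ⟨S, hS, rfl⟩
  exact ncard_le_ncard_of_isHittingSet hinj hfU (fun u hu => (hf u hu).2) hS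
end

section
/- Let G = (V, A) be a directed graph on a finite vertex set with no self-loops, and suppose V is partitioned into two disjoint sets V' and V'' such that every directed cycle of G has all of its vertices contained in V' or all of its vertices contained in V''. Then the survivability of G equals the sum of the survivabilities of the induced subgraphs on the two parts: |H(G)| = |H(G[V'])| + |H(G[V''])|, where G[W] denotes the subgraph of G induced on the vertex set W. -/
theorem isCycle_induced_iff {V : Type*} (A : Set (V × V)) (W : Set V) (l : List V) :
    IsCycle {a ∈ A | a.1 ∈ W ∧ a.2 ∈ W} l ↔ IsCycle A l ∧ ∀ v ∈ l, v ∈ W := by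
  constructor
  · rintro ⟨hlen, hnodup, harc⟩
    refine ⟨⟨hlen, hnodup, fun i => (harc i).1⟩, fun v hv => ?_⟩
    obtain ⟨i, rfl⟩ := List.get_of_mem hv
    exact (harc i).2.1
  · rintro ⟨⟨hlen, hnodup, harc⟩, hW⟩
    exact ⟨hlen, hnodup, fun i => ⟨harc i, hW _ (List.get_mem _ _), hW _ (List.get_mem _ _)⟩⟩

theorem surv_le_ncard {V : Type*} {A : Set (V × V)} {S : Set V} (hS : IsHittingSet A S) :
    surv A ≤ S.ncard :=
  Nat.sInf_le ⟨S, hS, rfl⟩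

theorem isHittingSet_univ {V : Type*} (A : Set (V × V)) : IsHittingSet A Set.univ := by
  rintro l ⟨hlen, -, -⟩
  exact ⟨l.get ⟨0, by omega⟩, Set.mem_univ _, List.get_mem _ _⟩

theorem exists_isHittingSet_ncard_eq_surv {V : Type*} (A : Set (V × V)) :
    ∃ S : Set V, IsHittingSet A S ∧ S.ncard = surv A :=
  Nat.sInf_mem (s := {n | ∃ S : Set V, IsHittingSet A S ∧ S.ncard = n})
    ⟨_, Set.univ, isHittingSet_univ A, rfl⟩

theorem IsHittingSet.inter_induced {V : Type*} {A : Set (V × V)} {S : Set V}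
    (hS : IsHittingSet A S) (W : Set V) :
    IsHittingSet {a ∈ A | a.1 ∈ W ∧ a.2 ∈ W} (S ∩ W) := by
  intro l hl
  obtain ⟨hA, hW⟩ := (isCycle_induced_iff A W l).1 hl
  obtain ⟨v, hvS, hvl⟩ := hS l hA
  exact ⟨v, ⟨hvS, hW v hvl⟩, hvl⟩

theorem stmt10 {V : Type*} [Fintype V] (A : Set (V × V))
    (hloop : ∀ v : V, (v, v) ∉ A)
    (V' V'' : Set V) (hpart : V' ∪ V'' = Set.univ) (hdisj : Disjoint V' V'')
    (hcyc : ∀ l : List V, IsCycle A l →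
      (∀ v ∈ l, v ∈ V') ∨ (∀ v ∈ l, v ∈ V'')) :
    surv A = surv {a ∈ A | a.1 ∈ V' ∧ a.2 ∈ V'} +
             surv {a ∈ A | a.1 ∈ V'' ∧ a.2 ∈ V''} := by
  apply le_antisymm
  · obtain ⟨S, hS, hScard⟩ :=
      exists_isHittingSet_ncard_eq_surv {a ∈ A | a.1 ∈ V' ∧ a.2 ∈ V'}
    obtain ⟨T, hT, hTcard⟩ :=
      exists_isHittingSet_ncard_eq_surv {a ∈ A | a.1 ∈ V'' ∧ a.2 ∈ V''}
    rw [← hScard, ← hTcard]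
    refine (surv_le_ncard (S := S ∪ T) fun l hl => ?_).trans (Set.ncard_union_le S T)
    rcases hcyc l hl with h | h
    · obtain ⟨v, hv, hvl⟩ := hS l ((isCycle_induced_iff A V' l).2 ⟨hl, h⟩)
      exact ⟨v, Or.inl hv, hvl⟩
    · obtain ⟨v, hv, hvl⟩ := hT l ((isCycle_induced_iff A V'' l).2 ⟨hl, h⟩)
      exact ⟨v, Or.inr hv, hvl⟩
  · obtain ⟨S, hS, hScard⟩ := exists_isHittingSet_ncard_eq_surv A
    have hdisj' : Disjoint (S ∩ V') (S ∩ V'') :=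
      hdisj.mono Set.inter_subset_right Set.inter_subset_right
    calc _ ≤ (S ∩ V').ncard + (S ∩ V'').ncard :=
          add_le_add (surv_le_ncard (hS.inter_induced V')) (surv_le_ncard (hS.inter_induced V''))
      _ = S.ncard := by
          rw [← Set.ncard_union_eq hdisj', ← Set.inter_union_distrib_left, hpart, Set.inter_univ]
      _ = surv A := hScard
end

section
/- Let G = (V, A) be an interdependent network with parts V₁ and V₂ whose survivability attains the maximum value |H(G)| = |V₁^out|. Then every vertex u ∈ V₁^out belongs to a directed cycle of length 2, i.e., there exists v ∈ V₂ with both (u, v) ∈ A and (v, u) ∈ A. -/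
/-- In a cycle every vertex has a successor that again lies on the cycle. -/
theorem IsCycle.exists_succ {V : Type*} {A : Set (V × V)} {l : List V} (hl : IsCycle A l)
    {x : V} (hx : x ∈ l) : ∃ y ∈ l, (x, y) ∈ A := by
  obtain ⟨i, rfl⟩ := List.get_of_mem hx
  exact ⟨_, List.get_mem _ _, hl.2.2 i⟩

theorem stmt14 {V : Type*} [Fintype V] (A : Set (V × V))
    (hloop : ∀ v : V, (v, v) ∉ A)
    (V₁ V₂ : Set V) (hpart : V₁ ∪ V₂ = Set.univ) (hdisj : Disjoint V₁ V₂)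
    (hbip : ∀ a ∈ A, (a.1 ∈ V₁ ∧ a.2 ∈ V₂) ∨ (a.1 ∈ V₂ ∧ a.2 ∈ V₁))
    (hmax : surv A = {u ∈ V₁ | ∃ v : V, (u, v) ∈ A}.ncard) :
    ∀ u ∈ {u ∈ V₁ | ∃ v : V, (u, v) ∈ A},
      ∃ v ∈ V₂, (u, v) ∈ A ∧ (v, u) ∈ A := by
  rintro u ⟨hu, w, hw⟩
  by_contra hno
  have hside : ∀ {x y : V}, (x, y) ∈ A → x ∈ V₁ → y ∈ V₂ := fun {x y} h hx =>
    (hbip _ h).elim And.right fun h' => (Set.disjoint_left.mp hdisj hx h'.1).elim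
  have hside' : ∀ {x y : V}, (x, y) ∈ A → x ∈ V₂ → y ∈ V₁ := fun {x y} h hx =>
    (hbip _ h).elim (fun h' => (Set.disjoint_left.mp hdisj h'.1 hx).elim) And.right
  have hhit : IsHittingSet A ({u ∈ V₁ | ∃ v : V, (u, v) ∈ A} \ {u}) := by
    intro l hl
    by_contra hmiss
    have heq : ∀ x ∈ l, x ∈ V₁ → x = u := by
      intro x hx hx₁
      by_contra hne
      obtain ⟨y, -, hxy⟩ := hl.exists_succ hx
      exact hmiss ⟨x, ⟨⟨hx₁, y, hxy⟩, hne⟩, hx⟩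
    have hul : u ∈ l := by
      obtain ⟨x, hx⟩ := List.exists_mem_of_length_pos (show 0 < l.length by have := hl.1; omega)
      obtain ⟨y, hy, hxy⟩ := hl.exists_succ hx
      rcases hbip _ hxy with h | h
      · exact heq x hx h.1 ▸ hx
      · exact heq y hy h.2 ▸ hy
    obtain ⟨y, hy, huy⟩ := hl.exists_succ hul
    obtain ⟨z, hz, hyz⟩ := hl.exists_succ hy
    have hy₂ := hside huy hu
    obtain rfl := heq z hz (hside' hyz hy₂)
    exact hno ⟨y, hy₂, huy, hyz⟩
  have hlt := Set.ncard_sdiff_singleton_lt_of_mem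
    (show u ∈ {u ∈ V₁ | ∃ v : V, (u, v) ∈ A} from ⟨hu, w, hw⟩) (Set.toFinite _)
  have hle := surv_le_ncard hhit
  omega
end
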